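/- For a > 0 and a continuously differentiable, bounded function σ on [0,∞), the function s(x) = (1/(2a)) ∫₀^∞ e^{-|x-x'|/a} σ(x') dx' satisfies the singularly perturbed ODE a² s''(x) - s(x) = -σ(x) for all x > 0. -/

import Mathlib

open Real MeasureTheory

/-- For `a > 0` and a C¹ bounded `σ` on `[0,∞)`, the Eringen transform
`s(x) = (1/(2a)) ∫₀^∞ e^{-|x-x'|/a} σ(x') dx'` satisfies
`a² s'' - s = -σ` for all `x > 0`. -/
theorem stmt_0 (a : ℝ) (ha : 0 < a) (σ s : ℝ → ℝ)
    (hσ : ContDiff ℝ 1 σ)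
    (hbdd : ∃ M, ∀ x ∈ Set.Ici (0 : ℝ), |σ x| ≤ M)
    (hs : ∀ x : ℝ, s x = (1 / (2 * a)) * ∫ x' in Set.Ioi (0 : ℝ),
      Real.exp (-|x - x'| / a) * σ x') :
    ∀ x : ℝ, 0 < x → a ^ 2 * deriv (deriv s) x - s x = -σ x := by
  obtain ⟨M, hM⟩ := hbdd
  have hc : Continuous σ := hσ.continuous
  have ha0 : a ≠ 0 := ha.ne'
  have hint : IntegrableOn (fun t => exp (-t / a) * σ t) (Set.Ioi 0) := by
    have h1 : IntegrableOn (fun t : ℝ => exp (-(1 / a) * t) * M) (Set.Ioi 0) :=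
      (exp_neg_integrableOn_Ioi 0 (by positivity)).mul_const M
    refine Integrable.mono' h1 (by fun_prop) ?_
    refine (ae_restrict_iff' measurableSet_Ioi).2 (Filter.Eventually.of_forall fun t ht => ?_)
    have h2 : -t / a = -(1 / a) * t := by ring
    rw [norm_mul, Real.norm_eq_abs, Real.norm_eq_abs, abs_of_pos (exp_pos _), h2]
    exact mul_le_mul_of_nonneg_left (hM t (Set.mem_Ici.2 (le_of_lt (Set.mem_Ioi.1 ht)))) (exp_pos _).le
  set C := ∫ t in Set.Ioi (0:ℝ), exp (-t / a) * σ t with hC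
  set P : ℝ → ℝ := fun x => ∫ t in (0:ℝ)..x, exp (t / a) * σ t with hP
  set Q : ℝ → ℝ := fun x => ∫ t in (0:ℝ)..x, exp (-t / a) * σ t with hQ
  have dP : ∀ x, HasDerivAt P (exp (x / a) * σ x) x := fun x =>
    Continuous.deriv_integral (fun t => exp (t / a) * σ t) (by fun_prop) 0 x ▸
      (intervalIntegral.integral_hasDerivAt_right
        (Continuous.intervalIntegrable (by fun_prop) _ _)
        (Continuous.stronglyMeasurableAtFilter (by fun_prop) _ _)
        (Continuous.continuousAt (by fun_prop))).differentiableAt.hasDerivAt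
  have dQ : ∀ x, HasDerivAt Q (exp (-x / a) * σ x) x := fun x =>
    Continuous.deriv_integral (fun t => exp (-t / a) * σ t) (by fun_prop) 0 x ▸
      (intervalIntegral.integral_hasDerivAt_right
        (Continuous.intervalIntegrable (by fun_prop) _ _)
        (Continuous.stronglyMeasurableAtFilter (by fun_prop) _ _)
        (Continuous.continuousAt (by fun_prop))).differentiableAt.hasDerivAt
  have key : ∀ x, 0 < x → s x = (1 / (2 * a)) *
      (exp (-x / a) * P x + exp (x / a) * (C - Q x)) := by
    intro x hx
    have hix : IntegrableOn (fun t => exp (-t / a) * σ t) (Set.Ioi x) :=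
      hint.mono_set (Set.Ioi_subset_Ioi hx.le)
    have hQC : Q x + ∫ t in Set.Ioi x, exp (-t / a) * σ t = C :=
      intervalIntegral.integral_interval_add_Ioi hint hix
    have e2 : Set.EqOn (fun t => exp (-|x - t| / a) * σ t)
        (fun t => exp (x / a) * (exp (-t / a) * σ t)) (Set.Ioi x) := by
      intro t ht
      have ht' : x < t := ht
      simp only
      rw [abs_of_neg (by linarith), ← mul_assoc, ← exp_add]
      congr 2
      ring
    have i2 : IntegrableOn (fun t => exp (-|x - t| / a) * σ t) (Set.Ioi x) :=
      (integrableOn_congr_fun e2 measurableSet_Ioi).2 (hix.const_mul _)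
    have ii : IntervalIntegrable (fun t => exp (-|x - t| / a) * σ t) volume 0 x :=
      Continuous.intervalIntegrable (by fun_prop) _ _
    have i1 : IntegrableOn (fun t => exp (-|x - t| / a) * σ t) (Set.Ioi 0) := by
      rw [← Set.Ioc_union_Ioi_eq_Ioi hx.le]
      exact ((intervalIntegrable_iff_integrableOn_Ioc_of_le hx.le).1 ii).union i2
    rw [hs x, ← intervalIntegral.integral_interval_add_Ioi i1 i2,
      setIntegral_congr_fun measurableSet_Ioi e2, integral_const_mul]
    have e1 : ∫ t in (0:ℝ)..x, exp (-|x - t| / a) * σ t = exp (-x / a) * P x := by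
      rw [hP, ← intervalIntegral.integral_const_mul]
      refine intervalIntegral.integral_congr fun t ht => ?_
      rw [Set.uIcc_of_le hx.le] at ht
      show exp (-|x - t| / a) * σ t = exp (-x / a) * (exp (t / a) * σ t)
      rw [abs_of_nonneg (by linarith [ht.2]), ← mul_assoc, ← exp_add]
      congr 2
      ring
    rw [e1, ← hQC]
    ring
  have dE : ∀ x, HasDerivAt (fun x : ℝ => exp (x / a)) (exp (x / a) * (1 / a)) x :=
    fun x => ((hasDerivAt_id x).div_const a).exp
  have dN : ∀ x, HasDerivAt (fun x : ℝ => exp (-x / a)) (exp (-x / a) * (-1 / a)) x :=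
    fun x => ((hasDerivAt_id x).neg.div_const a).exp
  have hE : ∀ x, exp (-x / a) * exp (x / a) = 1 := fun x => by
    rw [← exp_add, neg_div, neg_add_cancel, exp_zero]
  have d1 : ∀ x, 0 < x → deriv s x = (1 / (2 * a)) * ((1 / a) *
      (exp (x / a) * (C - Q x) - exp (-x / a) * P x)) := by
    intro x hx
    have h := ((((dN x).mul (dP x)).add ((dE x).mul ((dQ x).const_sub C))).const_mul (1 / (2 * a)))
    have h' := h.congr_of_eventuallyEq (f₁ := s)
      (Filter.eventually_of_mem (Ioi_mem_nhds hx) fun y hy => key y hy)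
    rw [h'.deriv]
    ring
  intro x hx
  have h := ((((dE x).mul ((dQ x).const_sub C)).sub ((dN x).mul (dP x))).const_mul (1 / a)).const_mul (1 / (2 * a))
  have h' := h.congr_of_eventuallyEq (f₁ := deriv s)
      (Filter.eventually_of_mem (Ioi_mem_nhds hx) fun y hy => d1 y hy)
  rw [h'.deriv, key x hx]
  have := hE x
  field_simp
  simp only [neg_div] at *
  linear_combination (-2 * a * σ x) * this
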